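/- Let n ≥ 1, let 0 ≤ k ≤ n be an integer, let m be a positive integer, and let a ∈ ½ℤ with a ≥ 0. Then, as an identity of rational functions in ℚ(x_1^{1/2},…,x_n^{1/2}), the sum of sp^{(k,n−k)}_{λ+(a^n)}(x_1,…,x_k | x_{k+1},…,x_n) over λ ∈ Even′((m^n)) minus the sum of sp^{(k,n−k)}_{λ+(a^n)}(x_1,…,x_k | x_{k+1},…,x_n) over λ ∈ Odd′((m^n)) equals (−1)^n · sp_{((m/2−1)^n)}(x_1,…,x_n) · so^D_{((m/2+a+1)^k)}(x_1,…,x_k) · ∏_{i=k+1}^n x_i^{m/2+a}(x_i − x_i^{−1}). -/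

import Mathlib

open Matrix BigOperators
open scoped Classical

noncomputable section

/-- The field `ℚ(t_1, …, t_n)` of rational functions in `n` indeterminates over `ℚ`. -/
abbrev FF (n : ℕ) : Type := FractionRing (MvPolynomial (Fin n) ℚ)

/-- The `i`-th indeterminate, viewed as an element of `FF n`. -/
def gen (n : ℕ) (i : Fin n) : FF n :=
  algebraMap (MvPolynomial (Fin n) ℚ) (FF n) (MvPolynomial.X i)

variable {F : Type*} [Field F]

/-- Symplectic character `sp_λ(x_1, …, x_N)`, in "doubled" form: `z i` represents
`x_i^{1/2}` and `μ i` represents `2·λ_i` (so half-integer weights are allowed). -/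
def spD {N : ℕ} (z : Fin N → F) (μ : Fin N → ℤ) : F :=
  Matrix.det (Matrix.of fun i j : Fin N =>
      z j ^ (μ i + 2 * ((N : ℤ) - (i : ℕ))) - z j ^ (-(μ i + 2 * ((N : ℤ) - (i : ℕ))))) /
  Matrix.det (Matrix.of fun i j : Fin N =>
      z j ^ (2 * ((N : ℤ) - (i : ℕ))) - z j ^ (-(2 * ((N : ℤ) - (i : ℕ)))))

/-- Odd orthogonal character `so^B_λ(x_1, …, x_N)`, in "doubled" form: `z i` represents
`x_i^{1/2}` and `μ i` represents `2·λ_i`. -/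
def soBD {N : ℕ} (z : Fin N → F) (μ : Fin N → ℤ) : F :=
  Matrix.det (Matrix.of fun i j : Fin N =>
      z j ^ (μ i + 2 * ((N : ℤ) - (i : ℕ)) - 1) -
        z j ^ (-(μ i + 2 * ((N : ℤ) - (i : ℕ)) - 1))) /
  Matrix.det (Matrix.of fun i j : Fin N =>
      z j ^ (2 * ((N : ℤ) - (i : ℕ)) - 1) - z j ^ (-(2 * ((N : ℤ) - (i : ℕ)) - 1)))

/-- Even orthogonal character `so^D_λ(x_1, …, x_N)`, in "doubled" form: `z i` represents
`x_i^{1/2}` and `μ i` represents `2·λ_i`; the factor is `2` if `λ_N > 0` and `1` otherwise. -/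
def soDD {N : ℕ} (z : Fin N → F) (μ : Fin N → ℤ) : F :=
  (if h : 0 < N then (if 0 < μ ⟨N - 1, Nat.sub_lt h Nat.one_pos⟩ then (2 : F) else 1) else 1) *
  (Matrix.det (Matrix.of fun i j : Fin N =>
      z j ^ (μ i + 2 * ((N : ℤ) - 1 - (i : ℕ))) +
        z j ^ (-(μ i + 2 * ((N : ℤ) - 1 - (i : ℕ))))) /
   Matrix.det (Matrix.of fun i j : Fin N =>
      z j ^ (2 * ((N : ℤ) - 1 - (i : ℕ))) + z j ^ (-(2 * ((N : ℤ) - 1 - (i : ℕ))))))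

/-- The matrix `Ā_λ` of the bialternant formula for the intermediate symplectic character
`sp^{(k, N-k)}`, in "doubled" form: `z i` represents `x_i^{1/2}`, `μ i` represents `2·λ_i`. -/
def interMatD {N : ℕ} (k : ℕ) (z : Fin N → F) (μ : Fin N → ℤ) : Matrix (Fin N) (Fin N) F :=
  Matrix.of fun i j : Fin N =>
    if (j : ℕ) < k then
      z j ^ (μ i + 2 * ((k : ℤ) - (i : ℕ))) /
          ∏ l ∈ Finset.univ.filter (fun l : Fin N => k ≤ (l : ℕ)), (1 - (z j ^ 2)⁻¹ * z l ^ 2) -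
        z j ^ (-(μ i + 2 * ((k : ℤ) - (i : ℕ)))) /
          ∏ l ∈ Finset.univ.filter (fun l : Fin N => k ≤ (l : ℕ)), (1 - z j ^ 2 * z l ^ 2)
    else z j ^ (μ i + 2 * ((N : ℤ) - 1 - (i : ℕ)))

/-- Intermediate symplectic character `sp^{(k, N-k)}_λ(x_1, …, x_k | x_{k+1}, …, x_N)`, in
"doubled" form: `z i` represents `x_i^{1/2}` and `μ i` represents `2·λ_i`. -/
def spInterD {N : ℕ} (k : ℕ) (z : Fin N → F) (μ : Fin N → ℤ) : F :=
  (interMatD k z μ).det / (interMatD k z fun _ => 0).det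

lemma sum_mul_prod_one_sub_mul_div (h2 : (2 : F) ≠ 0) (J : Finset F) (hsq : ∀ a ∈ J, a ^ 2 ≠ 1) :
    ∑ a ∈ J, a * ∏ b ∈ J.erase a, (1 - a * b) / (b - a) =
      ∏ a ∈ J, a - (1 + (-1) ^ J.card) / 2 := by
  have h1J : (1 : F) ∉ J := fun h => hsq 1 h (by norm_num)
  have h1J' : (-1 : F) ∉ J := fun h => hsq (-1) h (by norm_num)
  have h11 : (1 : F) ≠ -1 := fun h => h2 (by linear_combination h)
  have h1I : (1 : F) ∉ insert (-1) J := by simp [h11, h1J]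
  set P : Polynomial F := Polynomial.X * ∏ b ∈ J, (Polynomial.C (-b) * Polynomial.X + 1) with hP
  have hdegJ : (∏ b ∈ J, (Polynomial.C (-b) * Polynomial.X + 1)).natDegree ≤ J.card := by
    refine (Polynomial.natDegree_prod_le _ _).trans ?_
    rw [Finset.card_eq_sum_ones]
    exact Finset.sum_le_sum fun b _ => by compute_degree
  have hdeg : P.natDegree ≤ J.card + 1 := by
    refine Polynomial.natDegree_mul_le.trans ?_
    have := Polynomial.natDegree_X_le (R := F)
    omega
  have hcoefJ : (∏ b ∈ J, (Polynomial.C (-b) * Polynomial.X + 1)).coeff J.card = ∏ b ∈ J, (-b) := by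
    have := Polynomial.coeff_prod_of_natDegree_le J
      (fun b => Polynomial.C (-b) * Polynomial.X + 1) 1 (fun b _ => by compute_degree)
    rw [mul_one] at this
    rw [this]
    refine Finset.prod_congr rfl fun b _ => ?_
    simp [Polynomial.coeff_one]
  have hcard : (insert 1 (insert (-1) J)).card = J.card + 2 := by
    rw [Finset.card_insert_of_notMem h1I, Finset.card_insert_of_notMem h1J']
  have key := Lagrange.coeff_eq_sum (s := insert 1 (insert (-1) J)) (v := id) (P := P)
    Function.injective_id.injOn (by
      rw [hcard]
      refine lt_of_le_of_lt (Polynomial.degree_le_of_natDegree_le hdeg) ?_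
      exact_mod_cast Nat.lt_succ_self _)
  have hPe : ∀ t, P.eval t = t * ∏ b ∈ J, (1 - t * b) := by
    intro t
    simp only [hP, Polynomial.eval_mul, Polynomial.eval_X, Polynomial.eval_prod,
      Polynomial.eval_add, Polynomial.eval_C, Polynomial.eval_one]
    congr 1
    exact Finset.prod_congr rfl fun b _ => by ring
  have hcoef : P.coeff (J.card + 1) = (-1) ^ J.card * ∏ b ∈ J, b := by
    rw [hP, Polynomial.coeff_X_mul, hcoefJ, Finset.prod_neg]
  rw [hcard, show J.card + 2 - 1 = J.card + 1 from rfl, hcoef, Finset.sum_insert h1I,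
    Finset.sum_insert h1J'] at key
  simp only [id, hPe] at key
  have hne : ∀ t, t ∉ J → ∏ b ∈ J, (t - b) ≠ 0 := fun t ht =>
    Finset.prod_ne_zero_iff.2 fun b hb h => ht (by rwa [sub_eq_zero.1 h])
  have e1 : 1 * (∏ b ∈ J, (1 - 1 * b)) /
      ∏ j ∈ (insert 1 (insert (-1) J)).erase 1, (1 - j) = 1 / 2 := by
    rw [Finset.erase_insert h1I, Finset.prod_insert h1J']
    simp only [one_mul, sub_neg_eq_add]
    have := hne 1 h1J
    rw [show (1 : F) + 1 = 2 by norm_num]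
    field_simp
  have e2 : -1 * (∏ b ∈ J, (1 - -1 * b)) /
      ∏ j ∈ (insert 1 (insert (-1) J)).erase (-1), (-1 - j) = (-1) ^ J.card / 2 := by
    have : ∏ b ∈ J, (1 - -1 * b) = (-1) ^ J.card * ∏ b ∈ J, (-1 - b) := by
      rw [← Finset.prod_neg]
      exact Finset.prod_congr rfl fun b _ => by ring
    rw [Finset.insert_comm, Finset.erase_insert (by simp [h11.symm, h1J']), Finset.prod_insert h1J,
      this]
    have := hne _ h1J'
    have h3 : (-1 - 1 : F) ≠ 0 := fun h => h2 (by linear_combination -h)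
    rw [show (-1 - 1 : F) = -2 by norm_num]
    field_simp
  have e3 : ∀ a ∈ J, a * (∏ b ∈ J, (1 - a * b)) /
      ∏ j ∈ (insert 1 (insert (-1) J)).erase a, (a - j) =
        (-1) ^ J.card * (a * ∏ b ∈ J.erase a, (1 - a * b) / (b - a)) := by
    intro a ha
    have ha1 : (1 : F) ≠ a := fun h => h1J (h ▸ ha)
    have ha2 : (-1 : F) ≠ a := fun h => h1J' (h ▸ ha)
    rw [Finset.erase_insert_of_ne ha1, Finset.erase_insert_of_ne ha2, Finset.prod_insert,
      Finset.prod_insert, ← Finset.mul_prod_erase J _ ha, Finset.prod_div_distrib]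
    · have hc : J.card = (J.erase a).card + 1 := (Finset.card_erase_add_one ha).symm
      have : ∏ b ∈ J.erase a, (a - b) = (-1) ^ (J.erase a).card * ∏ b ∈ J.erase a, (b - a) := by
        rw [← Finset.prod_neg]
        exact Finset.prod_congr rfl fun b _ => by ring
      rw [this, hc, pow_succ]
      have hn : ∏ b ∈ J.erase a, (b - a) ≠ 0 := Finset.prod_ne_zero_iff.2 fun b hb h =>
        (Finset.mem_erase.1 hb).1 (sub_eq_zero.1 h)
      have h3 : a - 1 ≠ 0 := fun h => ha1 (sub_eq_zero.1 h).symm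
      have h4 : a - -1 ≠ 0 := fun h => ha2 (sub_eq_zero.1 h).symm
      have h5 : ((-1 : F) ^ (J.erase a).card) ^ 2 = 1 := by
        rw [← pow_mul, mul_comm, pow_mul]; simp
      have h6 : (-1 : F) ^ (J.erase a).card ≠ 0 := pow_ne_zero _ (by simp)
      rw [div_eq_iff (mul_ne_zero h3 (mul_ne_zero h4 (mul_ne_zero h6 hn)))]
      have h7 := div_mul_cancel₀ (∏ b ∈ J.erase a, (1 - a * b)) hn
      linear_combination -a * (1 - a ^ 2) * (∏ b ∈ J.erase a, (1 - a * b)) * h5 -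
        a * (1 - a ^ 2) * ((-1) ^ (J.erase a).card) ^ 2 * h7
    · simp [h1J']
    · simp [h11, h1J]
  rw [e1, e2, Finset.sum_congr rfl e3, ← Finset.mul_sum] at key
  have h5 : ((-1 : F) ^ J.card) * (-1) ^ J.card = 1 := by
    rw [← pow_add, ← two_mul, pow_mul]; simp
  have : ∀ {s A B : F}, s * s = 1 → s * A = 1 / 2 + (s / 2 + s * B) → B = A - (1 + s) / 2 := by
    intro s A B hs h
    field_simp at h ⊢
    linear_combination -s * h + (2 * A - 2 * B - 1) * hs
  exact this h5 key

/-- The product of `f (x i) (x j)` over all pairs `i < j`. -/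
def pairProd {n : ℕ} (f : F → F → F) (x : Fin n → F) : F :=
  ∏ i, ∏ j ∈ Finset.Ioi i, f (x i) (x j)

/-- The variables `x`, with those selected by `ε` inverted. -/
def flipInv {n : ℕ} (x : Fin n → F) (ε : Fin n → Bool) : Fin n → F :=
  fun j => if ε j then (x j)⁻¹ else x j

/-- The sign `(-1) ^ #ε`. -/
def flipSign {n : ℕ} (ε : Fin n → Bool) : F := ∏ j, if ε j then (-1 : F) else 1

/-- The monomial `∏ x j ^ L` over the variables selected by `ε`. -/
def flipWeight {n : ℕ} (ε : Fin n → Bool) (L : ℤ) (x : Fin n → F) : F :=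
  ∏ j, if ε j then x j ^ L else 1

/-- Nonzero variables, pairwise distinct and with no product of two of them equal to `1`. -/
structure Generic {n : ℕ} (x : Fin n → F) : Prop where
  ne_zero : ∀ i, x i ≠ 0
  inj : Function.Injective x
  mul_ne_one : ∀ i j, x i * x j ≠ 1

lemma Generic.comp {n m : ℕ} {x : Fin n → F} (hx : Generic x) {g : Fin m → Fin n}
    (hg : Function.Injective g) : Generic (x ∘ g) :=
  ⟨fun _ => hx.ne_zero _, hx.inj.comp hg, fun _ _ => hx.mul_ne_one _ _⟩

lemma Generic.flipInv {n : ℕ} {x : Fin n → F} (hx : Generic x) (ε : Fin n → Bool) :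
    Generic (flipInv x ε) := by
  refine ⟨fun i => ?_, fun i j h => ?_, fun i j h => ?_⟩
  · unfold _root_.flipInv
    split_ifs
    · exact inv_ne_zero (hx.ne_zero i)
    · exact hx.ne_zero i
  · have hi := hx.ne_zero i
    have hj := hx.ne_zero j
    unfold _root_.flipInv at h
    split_ifs at h with h1 h2 h2
    · exact hx.inj (inv_injective h)
    · exact absurd (by rw [← h, mul_inv_cancel₀ hi]) (hx.mul_ne_one i j)
    · exact absurd (by rw [h, inv_mul_cancel₀ hj]) (hx.mul_ne_one i j)
    · exact hx.inj h
  · have hi := hx.ne_zero i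
    have hj := hx.ne_zero j
    have hij := hx.mul_ne_one i j
    unfold _root_.flipInv at h
    split_ifs at h with h1 h2 h2
    · rw [← mul_inv, inv_eq_one] at h
      exact hij h
    · rw [inv_mul_eq_one₀ hi] at h
      rw [hx.inj h] at h1
      exact h2 h1
    · rw [mul_inv_eq_one₀ hj] at h
      rw [hx.inj h] at h1
      exact h1 h2
    · exact hij h

lemma pairProd_eq_prod_ite {n : ℕ} (f : F → F → F) (x : Fin n → F) :
    pairProd f x = ∏ i, ∏ j, if i < j then f (x i) (x j) else 1 := by
  unfold pairProd
  refine Finset.prod_congr rfl fun i _ => ?_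
  rw [← Finset.prod_filter]
  congr 1
  ext j
  simp

lemma pairProd_succAbove {n : ℕ} (f : F → F → F) (x : Fin (n + 1) → F) (i : Fin (n + 1)) :
    pairProd f x = (∏ b, if i < i.succAbove b then f (x i) (x (i.succAbove b))
      else f (x (i.succAbove b)) (x i)) * pairProd f (x ∘ i.succAbove) := by
  simp only [pairProd_eq_prod_ite]
  rw [Fin.prod_univ_succAbove _ i, Fin.prod_univ_succAbove _ i]
  simp only [lt_irrefl, if_false, one_mul]
  rw [Finset.prod_congr rfl fun b _ => Fin.prod_univ_succAbove
    (fun j => if i.succAbove b < j then f (x (i.succAbove b)) (x j) else 1) i,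
    Finset.prod_mul_distrib, ← mul_assoc, ← Finset.prod_mul_distrib]
  congr 1
  · refine Finset.prod_congr rfl fun b _ => ?_
    rcases lt_or_gt_of_ne (Fin.succAbove_ne i b) with h | h
    · simp [h, h.not_gt]
    · simp [h, h.not_gt]
  · simp

lemma pairProd_succAbove_of_symm {n : ℕ} (f : F → F → F) (hf : ∀ a b, f a b = f b a)
    (x : Fin (n + 1) → F) (i : Fin (n + 1)) :
    pairProd f x = (∏ b, f (x i) (x (i.succAbove b))) * pairProd f (x ∘ i.succAbove) := by
  rw [pairProd_succAbove f x i]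
  congr 1
  refine Finset.prod_congr rfl fun b _ => ?_
  split_ifs
  · rfl
  · exact hf _ _

lemma prod_succAbove_sign {n : ℕ} (i : Fin (n + 1)) :
    (∏ b, if i < i.succAbove b then (1 : F) else -1) = (-1) ^ (i : ℕ) := by
  have : ∀ b, (if i < i.succAbove b then (1 : F) else -1) =
      if (b : ℕ) < i then -1 else 1 := by
    intro b
    have hb : i < i.succAbove b ↔ ¬ (b : ℕ) < i := by
      rw [Fin.lt_succAbove_iff_le_castSucc, Fin.le_def, Fin.val_castSucc, not_lt]
    by_cases h : (b : ℕ) < i <;> simp [hb, h]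
  rw [Finset.prod_congr rfl fun b _ => this b, Fin.prod_univ_eq_prod_range
    (fun b => if b < (i : ℕ) then (-1 : F) else 1) n, ← Finset.prod_filter, Finset.prod_const]
  congr 1
  have : (Finset.range n).filter (fun b => b < (i : ℕ)) = Finset.range i := by
    ext b
    have := i.2
    simp
    omega
  rw [this, Finset.card_range]

lemma pairProd_sub_succAbove {n : ℕ} (x : Fin (n + 1) → F) (i : Fin (n + 1)) :
    pairProd (fun a b => a - b) x = (-1) ^ (i : ℕ) * (∏ b, (x i - x (i.succAbove b))) *
      pairProd (fun a b => a - b) (x ∘ i.succAbove) := by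
  rw [pairProd_succAbove _ x i, ← prod_succAbove_sign i, ← Finset.prod_mul_distrib]
  congr 1
  refine Finset.prod_congr rfl fun b _ => ?_
  split_ifs <;> ring

lemma Generic.pairProd_one_sub_mul_ne_zero {n : ℕ} {x : Fin n → F} (hx : Generic x) :
    pairProd (fun a b => 1 - a * b) x ≠ 0 :=
  Finset.prod_ne_zero_iff.2 fun i _ => Finset.prod_ne_zero_iff.2 fun j _ h =>
    hx.mul_ne_one i j (sub_eq_zero.1 h).symm

lemma sum_filter_mul_prod (h2 : (2 : F) ≠ 0) {n : ℕ} {x : Fin (n + 1) → F} (hx : Generic x)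
    (ε : Fin (n + 1) → Bool) :
    (∑ i, if ε i then x i * ∏ b, (if ε (i.succAbove b) then
        (1 - x i * x (i.succAbove b)) / (x (i.succAbove b) - x i) else 1) else 0) =
      flipWeight ε 1 x - (1 + flipSign ε) / 2 := by
  set I : Finset (Fin (n + 1)) := Finset.univ.filter fun i => ε i = true with hI
  have key := sum_mul_prod_one_sub_mul_div h2 (I.image x) (by
    intro a ha
    obtain ⟨i, -, rfl⟩ := Finset.mem_image.1 ha
    rw [sq]
    exact hx.mul_ne_one i i)
  rw [Finset.sum_image hx.inj.injOn, Finset.prod_image hx.inj.injOn,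
    Finset.card_image_of_injective _ hx.inj] at key
  have h1 : flipWeight ε 1 x = ∏ a ∈ I, x a := by
    simp [flipWeight, hI, Finset.prod_filter]
  have h3 : (flipSign ε : F) = (-1) ^ I.card := by
    rw [← Finset.prod_const, hI, Finset.prod_filter]
    rfl
  rw [h1, h3, ← key, ← Finset.sum_filter]
  refine Finset.sum_congr rfl fun i hi => ?_
  rw [← Finset.image_erase hx.inj, Finset.prod_image hx.inj.injOn]
  congr 1
  have : I.erase i = Finset.univ.filter fun j => j ≠ i ∧ ε j = true := by
    ext j
    simp [hI]
  rw [this, Finset.prod_filter, Fin.prod_univ_succAbove _ i]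
  simp [Fin.succAbove_ne]

lemma sum_flip_step (h2 : (2 : F) ≠ 0) {n : ℕ} {x : Fin (n + 1) → F} (hx : Generic x)
    (ε : Fin (n + 1) → Bool) (L : ℤ) :
    (∑ i : Fin (n + 1), if ε i then (-1) ^ (i : ℕ) * x i ^ (L - n) *
        (∏ b, (1 - x i * x (i.succAbove b))) *
        (flipWeight (ε ∘ i.succAbove) (L - 2) (x ∘ i.succAbove) *
        pairProd (fun a b => a - b) (flipInv (x ∘ i.succAbove) (ε ∘ i.succAbove))) else 0) =
      flipWeight ε (L - 1) x * pairProd (fun a b => a - b) (flipInv x ε) *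
        (flipWeight ε 1 x - (1 + flipSign ε) / 2) := by
  rw [← sum_filter_mul_prod h2 hx, Finset.mul_sum]
  refine Finset.sum_congr rfl fun i _ => ?_
  by_cases hi : ε i
  swap
  · simp [hi]
  rw [if_pos hi, if_pos hi, pairProd_sub_succAbove (flipInv x ε) i]
  have hw : flipWeight ε (L - 1) x = x i ^ (L - 1) *
      ∏ b, (if ε (i.succAbove b) then x (i.succAbove b) ^ (L - 1) else 1) := by
    unfold flipWeight
    rw [Fin.prod_univ_succAbove _ i, if_pos hi]
  have hprod : (∏ b, (1 - x i * x (i.succAbove b))) *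
      flipWeight (ε ∘ i.succAbove) (L - 2) (x ∘ i.succAbove) = x i ^ (n : ℤ) *
      ((∏ b, (if ε (i.succAbove b) then x (i.succAbove b) ^ (L - 1) else 1)) *
      (∏ b, (flipInv x ε i - flipInv x ε (i.succAbove b))) *
      ∏ b, (if ε (i.succAbove b) then
        (1 - x i * x (i.succAbove b)) / (x (i.succAbove b) - x i) else 1)) := by
    have : x i ^ (n : ℤ) = ∏ _b : Fin n, x i := by simp
    rw [this]
    unfold flipWeight
    simp only [← Finset.prod_mul_distrib]
    refine Finset.prod_congr rfl fun b _ => ?_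
    have h0 := hx.ne_zero i
    have hb0 := hx.ne_zero (i.succAbove b)
    have hs : x (i.succAbove b) - x i ≠ 0 := fun h =>
      Fin.succAbove_ne i b (hx.inj (sub_eq_zero.1 h))
    simp only [flipInv, hi, if_true, Function.comp]
    split_ifs with hb
    · rw [show L - 1 = L - 2 + 1 by ring, zpow_add_one₀ hb0]
      field_simp
    · field_simp
  have hpow : x i ^ (L - n) * x i ^ (n : ℤ) = x i ^ (L - 1) * x i := by
    rw [← zpow_add₀ (hx.ne_zero i), ← zpow_add_one₀ (hx.ne_zero i)]
    ring_nf
  have hcomp : flipInv x ε ∘ i.succAbove = flipInv (x ∘ i.succAbove) (ε ∘ i.succAbove) := rfl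
  rw [hw, hcomp]
  calc _ = (-1) ^ (i : ℕ) * x i ^ (L - n) * ((∏ b, (1 - x i * x (i.succAbove b))) *
        flipWeight (ε ∘ i.succAbove) (L - 2) (x ∘ i.succAbove)) *
        pairProd (fun a b => a - b) (flipInv (x ∘ i.succAbove) (ε ∘ i.succAbove)) := by ring
    _ = _ := by
      rw [hprod]
      linear_combination (-1) ^ (i : ℕ) *
        ((∏ b, (if ε (i.succAbove b) then x (i.succAbove b) ^ (L - 1) else 1)) *
        (∏ b, (flipInv x ε i - flipInv x ε (i.succAbove b))) *
        ∏ b, (if ε (i.succAbove b) then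
          (1 - x i * x (i.succAbove b)) / (x (i.succAbove b) - x i) else 1)) *
        pairProd (fun a b => a - b) (flipInv (x ∘ i.succAbove) (ε ∘ i.succAbove)) * hpow

/-- The signed sum over the flips `ε` of parity `c`, the numerator of a bounded Littlewood sum. -/
def flipSum (c : F) {n : ℕ} (L : ℤ) (x : Fin n → F) : F :=
  ∑ ε : Fin n → Bool, (1 + c * flipSign ε) / 2 *
    (flipWeight ε L x * pairProd (fun a b => a - b) (flipInv x ε))

lemma sum_bool_insertNth {n : ℕ} (i : Fin (n + 1)) (g : (Fin (n + 1) → Bool) → F) :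
    (∑ ε' : Fin n → Bool, g (i.insertNth true ε')) = ∑ ε, if ε i then g ε else 0 := by
  rw [← (Fin.insertNthEquiv (fun _ => Bool) i).sum_comp, Fintype.sum_prod_type]
  simp [Fin.insertNthEquiv]

lemma flipSum_step (h2 : (2 : F) ≠ 0) (c : F) {n : ℕ} {x : Fin (n + 1) → F} (hx : Generic x)
    (L : ℤ) :
    ∑ i : Fin (n + 1), (-1) ^ (i : ℕ) * x i ^ (L - n) *
        (∏ b, (1 - x i * x (i.succAbove b))) * flipSum c (L - 2) (x ∘ i.succAbove) =
      ∑ ε : Fin (n + 1) → Bool, (1 - c * flipSign ε) / 2 *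
        (flipWeight ε (L - 1) x * pairProd (fun a b => a - b) (flipInv x ε) *
        (flipWeight ε 1 x - (1 + flipSign ε) / 2)) := by
  simp only [← sum_flip_step h2 hx]
  simp only [Finset.mul_sum]
  rw [Finset.sum_comm]
  refine Finset.sum_congr rfl fun i _ => ?_
  rw [flipSum, Finset.mul_sum]
  have := sum_bool_insertNth i (fun ε => (1 - c * flipSign ε) / 2 *
    ((-1) ^ (i : ℕ) * x i ^ (L - n) *
        (∏ b, (1 - x i * x (i.succAbove b))) *
        (flipWeight (ε ∘ i.succAbove) (L - 2) (x ∘ i.succAbove) *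
        pairProd (fun a b => a - b) (flipInv (x ∘ i.succAbove) (ε ∘ i.succAbove)))))
  simp only [mul_ite, mul_zero]
  rw [← this]
  refine Finset.sum_congr rfl fun ε _ => ?_
  have h1 : (i.insertNth true ε : Fin (n + 1) → Bool) ∘ i.succAbove = ε := by
    ext b
    simp
  have h3 : (flipSign (i.insertNth true ε : Fin (n + 1) → Bool) : F) = - flipSign ε := by
    unfold flipSign
    rw [Fin.prod_univ_succAbove _ i]
    simp
  rw [h1, h3]
  ring

lemma flipSign_mul_self {n : ℕ} (ε : Fin n → Bool) : (flipSign ε : F) * flipSign ε = 1 := by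
  unfold flipSign
  rw [← Finset.prod_mul_distrib]
  exact Finset.prod_eq_one fun j _ => by split_ifs <;> simp

lemma flipWeight_add {n : ℕ} {x : Fin n → F} (hx : Generic x) (ε : Fin n → Bool) (K L : ℤ) :
    flipWeight ε (K + L) x = flipWeight ε K x * flipWeight ε L x := by
  unfold flipWeight
  rw [← Finset.prod_mul_distrib]
  refine Finset.prod_congr rfl fun j _ => ?_
  split_ifs
  · exact zpow_add₀ (hx.ne_zero j) _ _
  · simp

lemma flipSum_neg_one_eq (h2 : (2 : F) ≠ 0) {n : ℕ} {x : Fin (n + 1) → F} (hx : Generic x)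
    (L : ℤ) :
    flipSum (-1) L x = ∑ i : Fin (n + 1), (-1) ^ (i : ℕ) * x i ^ (L - n) *
        (∏ b, (1 - x i * x (i.succAbove b))) * flipSum 1 (L - 2) (x ∘ i.succAbove) := by
  rw [flipSum_step h2 1 hx, flipSum]
  refine Finset.sum_congr rfl fun ε _ => ?_
  rw [show L = L - 1 + 1 by ring, flipWeight_add hx, show L - 1 + 1 - 1 = L - 1 by ring]
  have := flipSign_mul_self (F := F) ε
  field_simp
  linear_combination -flipWeight ε (L - 1) x * pairProd (fun a b => a - b) (flipInv x ε) * this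

lemma flipSum_one_sub_eq (h2 : (2 : F) ≠ 0) {n : ℕ} {x : Fin (n + 1) → F} (hx : Generic x)
    (L : ℤ) :
    flipSum 1 L x - flipSum 1 (L - 1) x = ∑ i : Fin (n + 1), (-1) ^ (i : ℕ) * x i ^ (L - n) *
        (∏ b, (1 - x i * x (i.succAbove b))) * flipSum (-1) (L - 2) (x ∘ i.succAbove) := by
  rw [flipSum_step h2 (-1) hx, flipSum, flipSum, ← Finset.sum_sub_distrib]
  refine Finset.sum_congr rfl fun ε _ => ?_
  rw [show L = L - 1 + 1 by ring, flipWeight_add hx, show L - 1 + 1 - 1 = L - 1 by ring]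
  have := flipSign_mul_self (F := F) ε
  field_simp
  linear_combination flipWeight ε (L - 1) x * pairProd (fun a b => a - b) (flipInv x ε) * this

/-- The alternant `det (x j ^ p i)`. -/
def alternant {n : ℕ} (p : Fin n → ℕ) (x : Fin n → F) : F :=
  (Matrix.of fun i j => x j ^ p i).det

lemma alternant_rev {n : ℕ} (x : Fin n → F) :
    alternant (fun i => n - 1 - i) x = pairProd (fun a b => a - b) x := by
  have h := Matrix.det_projVandermonde (fun _ : Fin n => (1 : F)) x
  simp only [one_mul] at h
  rw [pairProd, ← h, ← Matrix.det_transpose, alternant]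
  congr 1
  ext i j
  simp only [Matrix.of_apply, Matrix.transpose_apply, Matrix.projVandermonde_apply, one_pow,
    one_mul, Fin.val_rev]
  congr 1
  omega

lemma det_sum_bool {n : ℕ} (g : Bool → Fin n → Fin n → F) :
    (Matrix.of fun i j => ∑ b, g b i j).det =
      ∑ ε : Fin n → Bool, (Matrix.of fun i j => g (ε j) i j).det := by
  have h := (Matrix.detRowAlternating (n := Fin n) (R := F)).toMultilinearMap.map_sum
    (fun (j : Fin n) (b : Bool) i => g b i j)
  have h1 : (Matrix.of fun i j => ∑ b, g b i j).det =
      (Matrix.detRowAlternating (n := Fin n) (R := F)).toMultilinearMap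
        (fun j => ∑ b, fun i => g b i j) := by
    rw [← Matrix.det_transpose]
    change _ = Matrix.det _
    congr 1
  rw [h1, h]
  refine Finset.sum_congr rfl fun ε _ => ?_
  rw [← Matrix.det_transpose]
  rfl

lemma det_add_flip_apply {n : ℕ} (c d : Fin n → F) (x : Fin n → F) (f : Fin n → F → F) :
    (Matrix.of fun i j => c j * f i (x j) + d j * f i (x j)⁻¹).det =
      ∑ ε : Fin n → Bool, (∏ j, if ε j then d j else c j) *
        (Matrix.of fun i j => f i (flipInv x ε j)).det := by
  have h := det_sum_bool fun (b : Bool) (i j : Fin n) =>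
    if b then d j * f i (x j)⁻¹ else c j * f i (x j)
  have h1 : (Matrix.of fun i j => c j * f i (x j) + d j * f i (x j)⁻¹) =
      Matrix.of fun i j => ∑ b : Bool, if b then d j * f i (x j)⁻¹ else c j * f i (x j) := by
    ext i j
    simp [add_comm]
  rw [h1, h]
  refine Finset.sum_congr rfl fun ε _ => ?_
  rw [← Matrix.det_mul_row]
  congr 1
  ext i j
  simp only [Matrix.of_apply, flipInv]
  split_ifs <;> rfl

lemma det_add_flip {n : ℕ} (c d : Fin n → F) (x : Fin n → F) (p : Fin n → ℕ) :
    (Matrix.of fun i j => c j * x j ^ p i + d j * (x j)⁻¹ ^ p i).det =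
      ∑ ε : Fin n → Bool, (∏ j, if ε j then d j else c j) * alternant p (flipInv x ε) :=
  det_add_flip_apply c d x fun i t => t ^ p i

lemma prod_flip_neg {n : ℕ} (L : ℤ) (x : Fin n → F) (ε : Fin n → Bool) :
    (∏ j, if ε j then -x j ^ L else 1) = flipSign ε * flipWeight ε L x := by
  unfold flipSign flipWeight
  rw [← Finset.prod_mul_distrib]
  exact Finset.prod_congr rfl fun j _ => by split_ifs <;> simp

lemma flipSum_sub_flipSum (h2 : (2 : F) ≠ 0) {n : ℕ} (L : ℤ) (x : Fin n → F) :
    flipSum 1 L x - flipSum (-1) L x =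
      (Matrix.of fun i j : Fin n => x j ^ (n - 1 - i : ℕ) -
        x j ^ L * (x j)⁻¹ ^ (n - 1 - i : ℕ)).det := by
  have h := det_add_flip (fun _ => 1) (fun j => -x j ^ L) x fun i : Fin n => n - 1 - i
  simp only [one_mul, neg_mul, ← sub_eq_add_neg] at h
  rw [h, flipSum, flipSum, ← Finset.sum_sub_distrib]
  refine Finset.sum_congr rfl fun ε _ => ?_
  rw [prod_flip_neg, alternant_rev]
  field_simp
  ring

/-- The partitions in an `n × m` rectangle whose column lengths all have the parity of `r`. -/
def colParts (r m n : ℕ) : Finset (Fin n → ℕ) :=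
  (Fintype.piFinset fun _ => Finset.range (m + 1)).filter fun lam =>
    Antitone lam ∧ ∀ c, 1 ≤ c → c ≤ m →
      Even ((Finset.univ.filter fun j => c ≤ lam j).card + r)

lemma mem_colParts {r m n : ℕ} {lam : Fin n → ℕ} :
    lam ∈ colParts r m n ↔ (∀ i, lam i ≤ m) ∧ Antitone lam ∧ ∀ c, 1 ≤ c → c ≤ m →
      Even ((Finset.univ.filter fun j => c ≤ lam j).card + r) := by
  simp [colParts]

lemma colParts_add_two (r m n : ℕ) : colParts (r + 2) m n = colParts r m n := by
  ext lam
  simp only [mem_colParts, ← add_assoc, Nat.even_add, even_two, iff_true]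

lemma antitone_cons {n a : ℕ} {lam : Fin n → ℕ} :
    Antitone (Fin.cons a lam : Fin (n + 1) → ℕ) ↔ (∀ i, lam i ≤ a) ∧ Antitone lam := by
  constructor
  · intro h
    refine ⟨fun i => ?_, fun i j hij => ?_⟩
    · simpa using h (Fin.zero_le i.succ)
    · simpa using h (Fin.succ_le_succ_iff.2 hij)
  · rintro ⟨h1, h2⟩ i j hij
    induction i using Fin.cases with
    | zero =>
      induction j using Fin.cases with
      | zero => rfl
      | succ j => simpa using h1 j
    | succ i =>
      induction j using Fin.cases with
      | zero => exact absurd hij (by simp)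
      | succ j => simpa using h2 (Fin.succ_le_succ_iff.1 hij)

lemma cons_mem_colParts {r m n : ℕ} {lam : Fin n → ℕ} :
    (Fin.cons m lam : Fin (n + 1) → ℕ) ∈ colParts r m (n + 1) ↔ lam ∈ colParts (r + 1) m n := by
  rw [mem_colParts, mem_colParts, antitone_cons, Fin.forall_fin_succ]
  simp only [Fin.cons_zero, Fin.cons_succ, le_refl, true_and]
  constructor
  · rintro ⟨h1, ⟨-, h2⟩, h3⟩
    refine ⟨h1, h2, fun c hc hcm => ?_⟩
    have := h3 c hc hcm
    rw [Fin.card_filter_univ_succ] at this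
    simp only [Fin.cons_zero, Fin.cons_succ, hcm, if_true] at this
    convert this using 1
    ring
  · rintro ⟨h1, h2, h3⟩
    refine ⟨h1, ⟨h1, h2⟩, fun c hc hcm => ?_⟩
    have := h3 c hc hcm
    rw [Fin.card_filter_univ_succ]
    simp only [Fin.cons_zero, Fin.cons_succ, hcm, if_true]
    convert this using 1
    ring

lemma mem_colParts_succ_of_lt {r m n : ℕ} {lam : Fin (n + 1) → ℕ} (h : lam 0 < m + 1) :
    lam ∈ colParts r (m + 1) (n + 1) ↔ Even r ∧ lam ∈ colParts r m (n + 1) := by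
  rw [mem_colParts, mem_colParts]
  constructor
  · rintro ⟨-, h2, h3⟩
    have hle : ∀ i, lam i ≤ m := fun i => (h2 (Fin.zero_le i)).trans (by omega)
    refine ⟨?_, hle, h2, fun c hc hcm => h3 c hc (by omega)⟩
    have := h3 (m + 1) (by omega) le_rfl
    rwa [Finset.card_eq_zero.2, zero_add] at this
    exact Finset.filter_eq_empty_iff.2 fun i _ => by have := hle i; omega
  · rintro ⟨hr, h1, h2, h3⟩
    refine ⟨fun i => (h1 i).trans (by omega), h2, fun c hc hcm => ?_⟩
    rcases Nat.lt_or_ge m c with hc' | hc'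
    · rwa [Finset.card_eq_zero.2, zero_add]
      exact Finset.filter_eq_empty_iff.2 fun i _ => by have := h1 i; omega
    · exact h3 c hc hc'

lemma sum_colParts_succ {r m n : ℕ} (g : (Fin (n + 1) → ℕ) → F) :
    ∑ lam ∈ colParts r (m + 1) (n + 1), g lam =
      (if Even r then ∑ lam ∈ colParts r m (n + 1), g lam else 0) +
      ∑ lam ∈ colParts (r + 1) (m + 1) n, g (Fin.cons (m + 1) lam) := by
  rw [← Finset.sum_filter_add_sum_filter_not _ fun lam => lam 0 < m + 1]
  congr 1
  · by_cases hr : Even r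
    · rw [if_pos hr]
      refine Finset.sum_congr ?_ fun _ _ => rfl
      ext lam
      rw [Finset.mem_filter]
      constructor
      · rintro ⟨h1, h2⟩
        exact ((mem_colParts_succ_of_lt h2).1 h1).2
      · intro h
        have h2 : lam 0 < m + 1 := Nat.lt_succ_of_le ((mem_colParts.1 h).1 0)
        exact ⟨(mem_colParts_succ_of_lt h2).2 ⟨hr, h⟩, h2⟩
    · rw [if_neg hr, Finset.filter_eq_empty_iff.2, Finset.sum_empty]
      intro lam h h2
      exact hr ((mem_colParts_succ_of_lt h2).1 h).1
  · symm
    refine Finset.sum_bij' (fun lam _ => Fin.cons (m + 1) lam) (fun lam _ => Fin.tail lam)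
      ?_ ?_ ?_ ?_ ?_
    · intro lam h
      simpa using cons_mem_colParts.2 h
    · intro lam h
      rw [Finset.mem_filter, not_lt] at h
      have h0 : lam 0 = m + 1 := le_antisymm ((mem_colParts.1 h.1).1 0) h.2
      rw [← cons_mem_colParts, ← h0, Fin.cons_self_tail, h0]
      exact h.1
    · intro lam _
      simp
    · intro lam h
      rw [Finset.mem_filter, not_lt] at h
      have h0 : lam 0 = m + 1 := le_antisymm ((mem_colParts.1 h.1).1 0) h.2
      rw [← h0, Fin.cons_self_tail]
    · intro _ _
      rfl

lemma colParts_zero (r n : ℕ) : colParts r 0 n = {fun _ => 0} := by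
  ext lam
  rw [mem_colParts, Finset.mem_singleton]
  constructor
  · rintro ⟨h, -⟩
    funext i
    exact Nat.le_zero.1 (h i)
  · rintro rfl
    exact ⟨fun _ => le_rfl, fun _ _ _ => le_rfl, fun c h1 h2 => by omega⟩

/-- The sum over `colParts r m n` of the numerators of the Schur polynomials. -/
def colSum (r m : ℕ) {n : ℕ} (x : Fin n → F) : F :=
  ∑ lam ∈ colParts r m n, alternant (fun i => lam i + (n - 1 - i)) x

lemma alternant_cons {n a : ℕ} (lam : Fin n → ℕ) (x : Fin (n + 1) → F) :
    alternant (fun i => (Fin.cons a lam : Fin (n + 1) → ℕ) i + (n + 1 - 1 - i)) x =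
      ∑ i : Fin (n + 1), (-1) ^ (i : ℕ) * x i ^ (a + n) *
        alternant (fun i => lam i + (n - 1 - i)) (x ∘ i.succAbove) := by
  rw [alternant, Matrix.det_succ_row_zero]
  refine Finset.sum_congr rfl fun i _ => ?_
  congr 2
  ext r s
  simp only [Matrix.submatrix_apply, Matrix.of_apply, Fin.cons_succ, Fin.val_succ,
    Function.comp]
  congr 2
  omega

lemma sum_colParts_cons {r m n a : ℕ} (x : Fin (n + 1) → F) :
    ∑ lam ∈ colParts r m n,
      alternant (fun i => (Fin.cons a lam : Fin (n + 1) → ℕ) i + (n + 1 - 1 - i)) x =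
      ∑ i : Fin (n + 1), (-1) ^ (i : ℕ) * x i ^ (a + n) * colSum r m (x ∘ i.succAbove) := by
  simp only [alternant_cons, colSum, Finset.mul_sum]
  exact Finset.sum_comm

lemma colSum_zero (r : ℕ) {n : ℕ} (x : Fin n → F) :
    colSum r 0 x = pairProd (fun a b => a - b) x := by
  rw [colSum, colParts_zero, Finset.sum_singleton, ← alternant_rev]
  simp

lemma colSum_one_succ (m : ℕ) {n : ℕ} (x : Fin (n + 1) → F) :
    colSum 1 (m + 1) x = ∑ i : Fin (n + 1), (-1) ^ (i : ℕ) * x i ^ (m + 1 + n) *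
      colSum 0 (m + 1) (x ∘ i.succAbove) := by
  rw [colSum, sum_colParts_succ, if_neg (by decide), zero_add, sum_colParts_cons]
  simp only [colSum, colParts_add_two 0]

lemma colSum_zero_succ (m : ℕ) {n : ℕ} (x : Fin (n + 1) → F) :
    colSum 0 (m + 1) x = colSum 0 m x + ∑ i : Fin (n + 1), (-1) ^ (i : ℕ) * x i ^ (m + 1 + n) *
      colSum 1 (m + 1) (x ∘ i.succAbove) := by
  rw [colSum, sum_colParts_succ, if_pos (by decide), sum_colParts_cons]
  rfl

lemma pairProd_sub_succ {n : ℕ} (x : Fin (n + 1) → F) :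
    pairProd (fun a b => a - b) x = ∑ i : Fin (n + 1), (-1) ^ (i : ℕ) * x i ^ n *
      pairProd (fun a b => a - b) (x ∘ i.succAbove) := by
  have h := alternant_cons (a := 0) (fun _ : Fin n => 0) x
  have h0 : (Fin.cons 0 fun _ : Fin n => 0 : Fin (n + 1) → ℕ) = fun _ => 0 := by
    funext i
    induction i using Fin.cases <;> simp
  simpa only [h0, zero_add, alternant_rev] using h

lemma pairProd_mul_sum_succAbove {n : ℕ} (x : Fin (n + 1) → F) (e : ℕ)
    (g : (Fin n → F) → F) :
    pairProd (fun a b => 1 - a * b) x *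
        ∑ i : Fin (n + 1), (-1) ^ (i : ℕ) * x i ^ e * g (x ∘ i.succAbove) =
      ∑ i : Fin (n + 1), (-1) ^ (i : ℕ) * x i ^ e * (∏ b, (1 - x i * x (i.succAbove b))) *
        (pairProd (fun a b => 1 - a * b) (x ∘ i.succAbove) * g (x ∘ i.succAbove)) := by
  rw [Finset.mul_sum]
  refine Finset.sum_congr rfl fun i _ => ?_
  rw [pairProd_succAbove_of_symm _ (fun a b => by rw [mul_comm]) x i]
  ring

lemma flipSum_one_eq_pairProd (h2 : (2 : F) ≠ 0) {n : ℕ} {x : Fin n → F} (hx : Generic x) :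
    flipSum 1 (2 * n - 2) x =
      pairProd (fun a b => 1 - a * b) x * pairProd (fun a b => a - b) x := by
  induction n with
  | zero => simp [flipSum, pairProd, flipSign, flipWeight, h2, one_add_one_eq_two]
  | succ n ih =>
    have h : flipSum 1 (2 * (n + 1 : ℕ) - 2) x - flipSum (-1) (2 * (n + 1 : ℕ) - 2) x = 0 := by
      rw [flipSum_sub_flipSum h2]
      refine Matrix.det_eq_zero_of_row_eq_zero 0 fun j => ?_
      have h0 := hx.ne_zero j
      simp only [Matrix.of_apply]
      rw [show (2 * ((n + 1 : ℕ) : ℤ) - 2) = ((n + n : ℕ) : ℤ) by push_cast; ring, zpow_natCast,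
        pow_add]
      simp [h0]
    rw [sub_eq_zero.1 h, flipSum_neg_one_eq h2 hx, pairProd_sub_succ,
      pairProd_mul_sum_succAbove x n (pairProd fun a b => a - b)]
    refine Finset.sum_congr rfl fun i _ => ?_
    rw [← ih (hx.comp i.succAbove_right_injective),
      show (2 * ((n + 1 : ℕ) : ℤ) - 2 - n) = n by push_cast; ring, zpow_natCast]
    congr 2
    push_cast
    ring

lemma pairProd_mul_colSum (h2 : (2 : F) ≠ 0) (m : ℕ) {n : ℕ} {x : Fin n → F} (hx : Generic x) :
    pairProd (fun a b => 1 - a * b) x * colSum 0 m x = flipSum 1 (m + 2 * n - 2) x ∧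
    (0 < m → pairProd (fun a b => 1 - a * b) x * colSum 1 m x =
      flipSum (-1) (m + 2 * n - 2) x) := by
  induction n generalizing m with
  | zero =>
    constructor
    · have : colParts 0 m 0 = {fun _ => 0} := by
        ext lam
        simp [mem_colParts, Subsingleton.antitone, Subsingleton.elim lam fun _ => 0]
      simp [colSum, this, pairProd, flipSum, flipSign, flipWeight, alternant, h2,
        one_add_one_eq_two]
    · intro hm
      have : colParts 1 m 0 = ∅ := by
        ext lam
        rw [mem_colParts]
        constructor
        · rintro ⟨-, -, h⟩
          exact absurd (h 1 le_rfl hm) (by simp)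
        · simp
      simp [colSum, this, pairProd, flipSum, flipSign, flipWeight]
  | succ n ih =>
    have odd : ∀ m, 0 < m → pairProd (fun a b => 1 - a * b) x * colSum 1 m x =
        flipSum (-1) (m + 2 * (n + 1 : ℕ) - 2) x := by
      intro m hm
      obtain ⟨m, rfl⟩ := Nat.exists_eq_add_one_of_ne_zero hm.ne'
      rw [colSum_one_succ, pairProd_mul_sum_succAbove x _ (colSum 0 (m + 1)),
        flipSum_neg_one_eq h2 hx]
      refine Finset.sum_congr rfl fun i _ => ?_
      rw [(ih (m + 1) (hx.comp i.succAbove_right_injective)).1,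
        show ((m + 1 : ℕ) : ℤ) + 2 * (n + 1 : ℕ) - 2 - n = ((m + 1 + n : ℕ) : ℤ) by push_cast; ring,
        zpow_natCast]
      congr 2
      push_cast
      ring
    refine ⟨?_, odd m⟩
    induction m with
    | zero =>
      rw [colSum_zero, ← flipSum_one_eq_pairProd h2 hx]
      simp
    | succ m ihm =>
      have h := flipSum_one_sub_eq h2 hx ((m + 1 : ℕ) + 2 * (n + 1 : ℕ) - 2)
      rw [colSum_zero_succ, mul_add, ihm,
        pairProd_mul_sum_succAbove x _ (colSum 1 (m + 1)), sub_eq_iff_eq_add'.1 h]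
      congr 1
      · congr 1
        push_cast
        ring
      · refine Finset.sum_congr rfl fun i _ => ?_
        rw [(ih (m + 1) (hx.comp i.succAbove_right_injective)).2 m.succ_pos,
          show ((m + 1 : ℕ) : ℤ) + 2 * (n + 1 : ℕ) - 2 - n = ((m + 1 + n : ℕ) : ℤ) by push_cast; ring,
          zpow_natCast]
        congr 2
        push_cast
        ring

/-- The alternating sum over even and odd column partitions, before division by the product
`∏ (1 - x i * x j)`. -/
lemma pairProd_mul_colSum_sub (h2 : (2 : F) ≠ 0) {m n : ℕ} (hm : 0 < m) {x : Fin n → F}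
    (hx : Generic x) :
    pairProd (fun a b => 1 - a * b) x * (colSum 0 m x - colSum 1 m x) =
      (Matrix.of fun i j : Fin n => x j ^ (n - 1 - i : ℕ) -
        x j ^ (m + 2 * n - 2 : ℤ) * (x j)⁻¹ ^ (n - 1 - i : ℕ)).det := by
  rw [mul_sub, (pairProd_mul_colSum h2 m hx).1, (pairProd_mul_colSum h2 m hx).2 hm,
    flipSum_sub_flipSum h2]

/-- The Vandermonde product in the variables `x j + (x j)⁻¹`. -/
def symVandermonde {n : ℕ} (x : Fin n → F) : F :=
  pairProd (fun a b => b + b⁻¹ - (a + a⁻¹)) x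

lemma add_inv_flipInv {n : ℕ} (x : Fin n → F) (ε : Fin n → Bool) (j : Fin n) :
    flipInv x ε j + (flipInv x ε j)⁻¹ = x j + (x j)⁻¹ := by
  unfold flipInv
  split_ifs
  · rw [inv_inv, add_comm]
  · rfl

lemma symVandermonde_flipInv {n : ℕ} (x : Fin n → F) (ε : Fin n → Bool) :
    symVandermonde (flipInv x ε) = symVandermonde x := by
  simp only [symVandermonde, pairProd, add_inv_flipInv]

lemma Generic.symVandermonde_ne_zero {n : ℕ} {x : Fin n → F} (hx : Generic x) :
    symVandermonde x ≠ 0 := by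
  unfold symVandermonde pairProd
  refine Finset.prod_ne_zero_iff.2 fun i _ => Finset.prod_ne_zero_iff.2 fun j hj h => ?_
  have hi0 := hx.ne_zero i
  have hj0 := hx.ne_zero j
  have h1 : (x j - x i) * (x i * x j - 1) = 0 := by
    field_simp at h
    linear_combination h
  rcases mul_eq_zero.1 h1 with h2 | h2
  · exact (Finset.mem_Ioi.1 hj).ne' (hx.inj (sub_eq_zero.1 h2))
  · exact hx.mul_ne_one i j (sub_eq_zero.1 h2)

lemma pairProd_mul {n : ℕ} (f g : F → F → F) (x : Fin n → F) :
    pairProd (fun a b => f a b * g a b) x = pairProd f x * pairProd g x := by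
  simp only [pairProd, Finset.prod_mul_distrib]

lemma pairProd_self_mul {n : ℕ} (x : Fin n → F) :
    pairProd (fun a b => a * b) x = ∏ j, x j ^ (n - 1) := by
  induction n with
  | zero => simp [pairProd]
  | succ n ih =>
    rw [pairProd_succAbove_of_symm _ mul_comm x 0, ih, Fin.prod_univ_succ]
    simp only [Finset.prod_mul_distrib, Finset.prod_const, Finset.card_univ, Fintype.card_fin,
      Fin.zero_succAbove, Function.comp, Nat.add_sub_cancel, mul_assoc]
    congr 1
    rw [← Finset.prod_mul_distrib]
    refine Finset.prod_congr rfl fun j _ => ?_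
    cases n with
    | zero => exact j.elim0
    | succ n => rw [Nat.add_sub_cancel, pow_succ']

lemma pairProd_one_sub_mul_mul_pairProd_sub {n : ℕ} {x : Fin n → F} (hx : Generic x) :
    pairProd (fun a b => 1 - a * b) x * pairProd (fun a b => a - b) x =
      (∏ j, x j ^ (n - 1)) * symVandermonde x := by
  rw [← pairProd_self_mul, symVandermonde, ← pairProd_mul, ← pairProd_mul]
  refine Finset.prod_congr rfl fun i _ => Finset.prod_congr rfl fun j _ => ?_
  have hi0 := hx.ne_zero i
  have hj0 := hx.ne_zero j
  field_simp
  ring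

/-- The numerators of the Weyl character formulas for rectangular weights. -/
def symDet {n : ℕ} (s : F) (b : ℤ) (z : Fin n → F) : F :=
  (Matrix.of fun i j : Fin n => z j ^ (b + 2 * (i : ℕ)) + s * z j ^ (-(b + 2 * (i : ℕ)))).det

lemma det_rev {n : ℕ} (s : F) (b : ℤ) (z : Fin n → F) :
    (Matrix.of fun i j : Fin n => z j ^ (b + 2 * ((n : ℤ) - 1 - (i : ℕ))) +
      s * z j ^ (-(b + 2 * ((n : ℤ) - 1 - (i : ℕ))))).det =
      Equiv.Perm.sign (Fin.revPerm (n := n)) * symDet s b z := by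
  rw [symDet, ← Matrix.det_permute]
  congr 1
  ext i j
  have : (((Fin.rev i : Fin n) : ℕ) : ℤ) = (n : ℤ) - 1 - (i : ℕ) := by
    rw [Fin.val_rev]
    have := i.2
    push_cast [Nat.cast_sub (show (i : ℕ) + 1 ≤ n by omega)]
    ring
  simp only [Matrix.submatrix_apply, Matrix.of_apply, Fin.revPerm_apply, id, this]

lemma sign_revPerm_ne_zero (n : ℕ) :
    ((Equiv.Perm.sign (Fin.revPerm (n := n)) : ℤ) : F) ≠ 0 := by
  rcases Int.units_eq_one_or (Equiv.Perm.sign (Fin.revPerm (n := n))) with h | h <;> simp [h]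

lemma spD_const {n : ℕ} (z : Fin n → F) (b : ℤ) :
    spD z (fun _ => b) = symDet (-1) (b + 2) z / symDet (-1) 2 z := by
  have h := det_rev (-1) (b + 2) z
  have h' := det_rev (-1) 2 z
  rw [spD, ← mul_div_mul_left (symDet (-1) (b + 2) z) _ (sign_revPerm_ne_zero (F := F) n), ← h, ← h']
  congr 3 <;>
  · ext i j
    ring_nf

lemma soDD_const {n : ℕ} (z : Fin n → F) {b : ℤ} (hb : 0 < b) :
    soDD z (fun _ => b) =
      (if 0 < n then 2 else 1) * (symDet 1 b z / symDet 1 0 z) := by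
  have h := det_rev 1 b z
  have h' := det_rev 1 0 z
  rw [soDD, ← mul_div_mul_left (symDet 1 b z) _ (sign_revPerm_ne_zero (F := F) n), ← h, ← h']
  congr 1
  · simp [hb]
  · congr 3 <;>
    · ext i j
      ring_nf

lemma symDet_neg_one_flipInv {n : ℕ} (b : ℤ) (z : Fin n → F) (ε : Fin n → Bool) :
    symDet (-1) b (flipInv z ε) = flipSign ε * symDet (-1) b z := by
  rw [symDet, symDet, flipSign, ← Matrix.det_mul_row]
  congr 1
  ext i j
  simp only [Matrix.of_apply, flipInv]
  split_ifs
  · rw [_root_.inv_zpow', _root_.inv_zpow', neg_neg]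
    ring
  · ring

lemma det_eval_eq_pairProd {n : ℕ} (v : Fin n → F) (p : Fin n → Polynomial F)
    (h_deg : ∀ i, (p i).natDegree = i) (h_monic : ∀ i, (p i).Monic) :
    (Matrix.of fun i j => (p i).eval (v j)).det = pairProd (fun a b => b - a) v := by
  rw [pairProd, ← Matrix.det_vandermonde,
    Matrix.det_eval_matrixOfPolynomials_eq_det_vandermonde v p h_deg h_monic,
    ← Matrix.det_transpose]
  rfl

lemma monic_of_recurrence {P : ℕ → Polynomial F} (h0 : (P 0).natDegree = 0)
    (h1 : P 1 = Polynomial.X) (h : ∀ n, P (n + 2) = Polynomial.X * P (n + 1) - P n) (n : ℕ) :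
    (P (n + 1)).Monic ∧ (P (n + 1)).natDegree = n + 1 ∧ (P n).natDegree = n := by
  induction n with
  | zero => simp [h0, h1]
  | succ n ih =>
    obtain ⟨ihm, ihd, ihd'⟩ := ih
    have hm : (Polynomial.X * P (n + 1)).Monic := Polynomial.monic_X.mul ihm
    have hd : (Polynomial.X * P (n + 1)).natDegree = n + 2 := by
      rw [Polynomial.monic_X.natDegree_mul ihm, ihd, Polynomial.natDegree_X]
      ring
    have hlt : (P n).natDegree < (Polynomial.X * P (n + 1)).natDegree := by omega
    rw [h n]
    refine ⟨hm.sub_of_left (Polynomial.degree_lt_degree hlt), ?_, ihd⟩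
    rw [Polynomial.natDegree_sub_eq_left_of_natDegree_lt hlt, hd]

lemma eval_chebyshev_S {x : F} (hx : x ≠ 0) (n : ℕ) :
    (Polynomial.Chebyshev.S F n).eval (x + x⁻¹) * (x - x⁻¹) = x ^ (n + 1) - x⁻¹ ^ (n + 1) := by
  induction n using Nat.twoStepInduction with
  | zero => simp
  | one =>
    simp
    ring
  | more n ih ih' =>
    push_cast at ih' ⊢
    rw [Polynomial.Chebyshev.S_add_two, Polynomial.eval_sub, Polynomial.eval_mul,
      Polynomial.eval_X, sub_mul, ih, mul_assoc, ih']
    have : x * x⁻¹ = 1 := mul_inv_cancel₀ hx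
    linear_combination (x ^ (n + 1) - x⁻¹ ^ (n + 1)) * this

lemma eval_chebyshev_C {x : F} (hx : x ≠ 0) (n : ℕ) :
    (Polynomial.Chebyshev.C F n).eval (x + x⁻¹) = x ^ n + x⁻¹ ^ n := by
  induction n using Nat.twoStepInduction with
  | zero => norm_num
  | one => simp
  | more n ih ih' =>
    push_cast at ih' ⊢
    rw [Polynomial.Chebyshev.C_add_two, Polynomial.eval_sub, Polynomial.eval_mul,
      Polynomial.eval_X, ih, ih']
    have : x * x⁻¹ = 1 := mul_inv_cancel₀ hx
    linear_combination (x ^ n + x⁻¹ ^ n) * this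

lemma symDet_neg_one_two {n : ℕ} {z : Fin n → F} (hz : ∀ j, z j ≠ 0) :
    symDet (-1) 2 z =
      (∏ j, (z j ^ 2 - (z j ^ 2)⁻¹)) * symVandermonde fun j => z j ^ 2 := by
  have hS := monic_of_recurrence (F := F) (P := fun n : ℕ => Polynomial.Chebyshev.S F n)
    (by simp) (by simp) (fun n => by push_cast; exact Polynomial.Chebyshev.S_add_two F n)
  have h := det_eval_eq_pairProd (fun j => z j ^ 2 + (z j ^ 2)⁻¹)
    (fun i : Fin n => Polynomial.Chebyshev.S F (i : ℕ)) (fun i => (hS i).2.2) (fun i => by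
      rcases i with ⟨_ | i, hi⟩
      · simp
      · exact (hS i).1)
  have hW : (symVandermonde fun j => z j ^ 2) =
    pairProd (fun a b => b - a) fun j => z j ^ 2 + (z j ^ 2)⁻¹ := rfl
  rw [hW, ← h, ← Matrix.det_mul_row, symDet]
  congr 1
  ext i j
  have := eval_chebyshev_S (pow_ne_zero 2 (hz j)) i
  rw [Matrix.of_apply, Matrix.of_apply, Matrix.of_apply, mul_comm (_ - _), this, ← inv_pow,
    ← pow_mul, ← pow_mul, _root_.zpow_neg, ← _root_.inv_zpow,
    show (2 + 2 * ((i : ℕ) : ℤ)) = ((2 * ((i : ℕ) + 1) : ℕ) : ℤ) by push_cast; ring,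
    zpow_natCast, zpow_natCast]
  ring

lemma symDet_one_zero {n : ℕ} {z : Fin n → F} (hz : ∀ j, z j ≠ 0) :
    symDet 1 0 z = (if 0 < n then 2 else 1) * symVandermonde fun j => z j ^ 2 := by
  rcases n with _ | n
  · simp [symDet, symVandermonde, pairProd]
  have hC := monic_of_recurrence (F := F) (P := fun n : ℕ => Polynomial.Chebyshev.C F n)
    (by simp) (by simp) (fun n => by push_cast; exact Polynomial.Chebyshev.C_add_two F n)
  have h := det_eval_eq_pairProd (fun j => z j ^ 2 + (z j ^ 2)⁻¹)
    (fun i : Fin (n + 1) => if i = 0 then 1 else Polynomial.Chebyshev.C F (i : ℕ)) (fun i => by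
      split_ifs with hi
      · simp [hi]
      · exact (hC i).2.2) (fun i => by
      split_ifs with hi
      · exact Polynomial.monic_one
      · obtain ⟨i, rfl⟩ := Fin.exists_succ_eq.2 hi
        exact (hC i).1)
  have hW : (symVandermonde fun j => z j ^ 2) =
    pairProd (fun a b => b - a) fun j => z j ^ 2 + (z j ^ 2)⁻¹ := rfl
  have h2 : (if 0 < n + 1 then (2 : F) else 1) =
      ∏ i : Fin (n + 1), if i = 0 then (2 : F) else 1 := by simp
  rw [hW, ← h, h2, ← Matrix.det_mul_column, symDet]
  congr 1
  ext i j
  have := eval_chebyshev_C (pow_ne_zero 2 (hz j)) i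
  simp only [Matrix.of_apply]
  split_ifs with hi
  · simp [hi, one_add_one_eq_two]
  · rw [this, ← inv_pow, ← pow_mul, ← pow_mul, _root_.zpow_neg, ← _root_.inv_zpow,
      show (0 + 2 * ((i : ℕ) : ℤ)) = ((2 * (i : ℕ) : ℕ) : ℤ) by push_cast; ring,
      zpow_natCast, zpow_natCast]
    ring

/-- The alternating sum over even and odd column partitions is a symplectic numerator. -/
lemma colSum_sub_mul_symVandermonde (h2 : (2 : F) ≠ 0) {m n : ℕ} (hm : 0 < m) {z : Fin n → F}
    (hz : Generic fun j => z j ^ 2) :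
    (colSum 0 m (fun j => z j ^ 2) - colSum 1 m fun j => z j ^ 2) *
        symVandermonde (fun j => z j ^ 2) =
      (-1) ^ n * (∏ j, z j ^ (m : ℤ)) * symDet (-1) m z *
        pairProd (fun a b => a - b) fun j => z j ^ 2 := by
  have hz0 : ∀ j, z j ≠ 0 := fun j h => hz.ne_zero j (by simp [h])
  have h1 := pairProd_mul_colSum_sub h2 hm hz
  have h3 := pairProd_one_sub_mul_mul_pairProd_sub hz
  have h4 : (Matrix.of fun i j : Fin n => (z j ^ 2) ^ (n - 1 - i : ℕ) -
      (z j ^ 2) ^ (m + 2 * n - 2 : ℤ) * (z j ^ 2)⁻¹ ^ (n - 1 - i : ℕ)).det =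
      (-1) ^ n * ((∏ j, z j ^ (m : ℤ)) * ∏ j, (z j ^ 2) ^ (n - 1)) * symDet (-1) m z := by
    have hs : ((-1 : F)) ^ n = ∏ _j : Fin n, (-1 : F) := by simp
    rw [hs, ← Finset.prod_mul_distrib, ← Finset.prod_mul_distrib, symDet, ← Matrix.det_mul_row]
    congr 1
    ext i j
    have hj := hz0 j
    have hi : ((n - 1 - i : ℕ) : ℤ) = n - 1 - (i : ℕ) := by
      have := i.2
      omega
    have hn : ((n - 1 : ℕ) : ℤ) = n - 1 := by
      have := i.2
      omega
    simp only [Matrix.of_apply, ← zpow_natCast, hi, hn]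
    simp only [_root_.inv_zpow', ← _root_.zpow_mul, ← zpow_add₀ hj, mul_add,
      neg_mul, one_mul, mul_neg, neg_neg]
    rw [sub_eq_neg_add]
    congr 2 <;> ring_nf
  rw [h4] at h1
  have hB := hz.pairProd_one_sub_mul_ne_zero
  have hP : (∏ j, (z j ^ 2) ^ (n - 1)) ≠ 0 :=
    Finset.prod_ne_zero_iff.2 fun j _ => pow_ne_zero _ (hz.ne_zero j)
  refine mul_left_cancel₀ hP ?_
  linear_combination (pairProd (fun a b => a - b) fun j => z j ^ 2) * h1 -
    (colSum 0 m (fun j => z j ^ 2) - colSum 1 m fun j => z j ^ 2) * h3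

lemma det_eval_rev {n : ℕ} (v : Fin n → F) (p : Fin n → Polynomial F)
    (h_deg : ∀ i, (p i).natDegree = n - 1 - i) (h_monic : ∀ i, (p i).Monic) :
    (Matrix.of fun i j => (p i).eval (v j)).det = pairProd (fun a b => a - b) v := by
  have hrev : ∀ i : Fin n, n - 1 - (Fin.rev i : ℕ) = i := fun i => by
    rw [Fin.val_rev]
    omega
  have key : ∀ q : Fin n → Polynomial F, (∀ i, (q i).natDegree = n - 1 - i) →
      (∀ i, (q i).Monic) → (Equiv.Perm.sign (Fin.revPerm (n := n)) : F) *
      (Matrix.of fun i j => (q i).eval (v j)).det = pairProd (fun a b => b - a) v := by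
    intro q hd hm
    rw [← Matrix.det_permute, ← det_eval_eq_pairProd v (fun i => q (Fin.rev i))
      (fun i => by rw [hd, hrev]) (fun i => hm _)]
    rfl
  have h1 := key (fun i => Polynomial.X ^ (n - 1 - i : ℕ)) (fun i => by simp)
    (fun i => Polynomial.monic_X_pow _)
  have h2 := key p h_deg h_monic
  refine mul_left_cancel₀ (sign_revPerm_ne_zero (F := F) n) ?_
  rw [h2, ← h1, ← alternant_rev, alternant]
  simp

lemma det_add_flip_eval {n : ℕ} (c d : Fin n → F) (x : Fin n → F) (p : Fin n → Polynomial F)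
    (h_deg : ∀ i, (p i).natDegree = n - 1 - i) (h_monic : ∀ i, (p i).Monic) :
    (Matrix.of fun i j : Fin n =>
      c j * x j ^ (n - 1 - i : ℕ) + d j * (x j)⁻¹ ^ (n - 1 - i : ℕ)).det =
      (Matrix.of fun i j => c j * (p i).eval (x j) + d j * (p i).eval (x j)⁻¹).det := by
  rw [det_add_flip, det_add_flip_apply c d x fun i t => (p i).eval t]
  simp only [det_eval_rev _ p h_deg h_monic, alternant_rev]

/-- The coefficient of the positive powers of `x j = z j ^ 2` in column `j` of the bialternant
matrix of the intermediate symplectic characters. -/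
def interPos {n : ℕ} (k : ℕ) (z : Fin n → F) (b : ℤ) (j : Fin n) : F :=
  if (j : ℕ) < k then z j ^ (b + 2 * ((k : ℤ) - n + 1)) /
    ∏ l ∈ Finset.univ.filter (fun l : Fin n => k ≤ (l : ℕ)), (1 - (z j ^ 2)⁻¹ * z l ^ 2)
  else z j ^ b

/-- The coefficient of the negative powers of `x j = z j ^ 2` in column `j` of the bialternant
matrix, where the sign `-1` is replaced by `s`. -/
def interNeg {n : ℕ} (s : F) (k : ℕ) (z : Fin n → F) (b : ℤ) (j : Fin n) : F :=
  if (j : ℕ) < k then s * z j ^ (-(b + 2 * ((k : ℤ) - n + 1))) /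
    ∏ l ∈ Finset.univ.filter (fun l : Fin n => k ≤ (l : ℕ)), (1 - z j ^ 2 * z l ^ 2)
  else 0

lemma interMatD_eq {n : ℕ} (k : ℕ) {z : Fin n → F} (hz : ∀ j, z j ≠ 0) (b : ℤ)
    (lam : Fin n → ℕ) :
    interMatD k z (fun i => 2 * (lam i : ℤ) + b) = Matrix.of fun i j : Fin n =>
      interPos k z b j * (z j ^ 2) ^ (lam i + (n - 1 - i)) +
        interNeg (-1) k z b j * (z j ^ 2)⁻¹ ^ (lam i + (n - 1 - i)) := by
  ext i j
  have hj := hz j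
  have hi : (2 * ((lam i + (n - 1 - i) : ℕ) : ℤ)) = 2 * lam i + 2 * (n - 1 - (i : ℕ)) := by
    have := i.2
    push_cast [Nat.cast_sub (show (i : ℕ) ≤ n - 1 by omega), Nat.cast_sub (show 1 ≤ n by omega)]
    ring
  have h1 : (z j ^ 2) ^ (lam i + (n - 1 - i)) = z j ^ (2 * (lam i : ℤ) + 2 * (n - 1 - (i : ℕ))) := by
    rw [← hi, ← pow_mul, ← zpow_natCast]
    push_cast
    rfl
  simp only [interMatD, Matrix.of_apply, inv_pow, h1, interPos, interNeg,
    ← _root_.zpow_neg]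
  split_ifs
  · rw [div_mul_eq_mul_div, ← zpow_add₀ hj, div_mul_eq_mul_div, mul_assoc, ← zpow_add₀ hj,
      neg_one_mul, neg_div, ← sub_eq_add_neg]
    ring_nf
  · rw [← zpow_add₀ hj, zero_mul, add_zero]
    ring_nf

lemma sum_interMatD {n : ℕ} (h2 : (2 : F) ≠ 0) (k : ℕ) {m : ℕ} (hm : 0 < m) {z : Fin n → F}
    (hz : Generic fun j => z j ^ 2) (b : ℤ) :
    (∑ lam ∈ colParts 0 m n, (interMatD k z fun i => 2 * (lam i : ℤ) + b).det -
        ∑ lam ∈ colParts 1 m n, (interMatD k z fun i => 2 * (lam i : ℤ) + b).det) *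
      symVandermonde (fun j => z j ^ 2) =
    (-1) ^ n * symDet (-1) m z * (Matrix.of fun i j : Fin n =>
      interPos k z (b + m) j * (z j ^ 2) ^ (n - 1 - i : ℕ) +
        interNeg 1 k z (b + m) j * (z j ^ 2)⁻¹ ^ (n - 1 - i : ℕ)).det := by
  have hz0 : ∀ j, z j ≠ 0 := fun j h => hz.ne_zero j (by simp [h])
  have hsum : ∀ r, ∑ lam ∈ colParts r m n, (interMatD k z fun i => 2 * (lam i : ℤ) + b).det =
      ∑ ε : Fin n → Bool, (∏ j, if ε j then interNeg (-1) k z b j else interPos k z b j) *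
        colSum r m (flipInv (fun j => z j ^ 2) ε) := by
    intro r
    simp only [colSum, Finset.mul_sum]
    rw [Finset.sum_comm]
    refine Finset.sum_congr rfl fun lam _ => ?_
    rw [interMatD_eq k hz0, det_add_flip]
  rw [hsum, hsum, ← Finset.sum_sub_distrib, Finset.sum_mul, det_add_flip, Finset.mul_sum]
  refine Finset.sum_congr rfl fun ε _ => ?_
  have hflip : (fun j => flipInv z ε j ^ 2) = flipInv (fun j => z j ^ 2) ε := by
    funext j
    unfold flipInv
    split_ifs <;> simp
  have h := colSum_sub_mul_symVandermonde h2 hm (z := flipInv z ε)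
    (by rw [hflip]; exact hz.flipInv ε)
  rw [hflip, symVandermonde_flipInv, symDet_neg_one_flipInv] at h
  have hprod : (∏ j, if ε j then interNeg 1 k z (b + m) j else interPos k z (b + m) j) =
      (∏ j, if ε j then interNeg (-1) k z b j else interPos k z b j) *
        (flipSign ε * ∏ j, flipInv z ε j ^ (m : ℤ)) := by
    rw [flipSign, ← Finset.prod_mul_distrib, ← Finset.prod_mul_distrib]
    refine Finset.prod_congr rfl fun j _ => ?_
    have hj := hz0 j
    unfold interPos interNeg flipInv
    split_ifs
    · rw [_root_.inv_zpow', show -(b + m + 2 * ((k : ℤ) - n + 1)) =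
        -(b + 2 * ((k : ℤ) - n + 1)) + -m by ring, zpow_add₀ hj]
      ring
    · simp
    · rw [show b + m + 2 * ((k : ℤ) - n + 1) = b + 2 * ((k : ℤ) - n + 1) + m by ring,
        zpow_add₀ hj]
      ring
    · rw [zpow_add₀ hj]
      ring
  rw [hprod, alternant_rev]
  linear_combination (∏ j, if ε j then interNeg (-1) k z b j else interPos k z b j) * h

lemma prod_filter_le_val {k l : ℕ} (g : Fin (k + l) → F) :
    ∏ i ∈ Finset.univ.filter (fun i : Fin (k + l) => k ≤ (i : ℕ)), g i =
      ∏ r, g (Fin.natAdd k r) := by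
  rw [Finset.prod_filter, Fin.prod_univ_add]
  simp [fun i : Fin k => i.2.not_ge]

lemma det_inter {k l : ℕ} (s : F) {z : Fin (k + l) → F} (hz : Generic fun j => z j ^ 2) (b : ℤ) :
    (Matrix.of fun i j : Fin (k + l) =>
      interPos k z b j * (z j ^ 2) ^ (k + l - 1 - i : ℕ) +
        interNeg s k z b j * (z j ^ 2)⁻¹ ^ (k + l - 1 - i : ℕ)).det =
    Equiv.Perm.sign (Fin.revPerm (n := k)) * symDet s (b + 2) (z ∘ Fin.castAdd l) *
      ((∏ r, z (Fin.natAdd k r) ^ b) *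
        pairProd (fun a b => a - b) fun r => z (Fin.natAdd k r) ^ 2) := by
  have hz0 : ∀ j, z j ≠ 0 := fun j h => hz.ne_zero j (by simp [h])
  set q : Polynomial F := ∏ r : Fin l, (Polynomial.X - Polynomial.C (z (Fin.natAdd k r) ^ 2))
    with hq
  have hqm : q.Monic := Polynomial.monic_prod_X_sub_C _ _
  have hqd : q.natDegree = l := by
    rw [hq, Polynomial.natDegree_finsetProd_X_sub_C_eq_card]
    simp
  set p : Fin (k + l) → Polynomial F := fun i =>
    if (i : ℕ) < k then q * Polynomial.X ^ (k - 1 - i : ℕ)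
    else Polynomial.X ^ (k + l - 1 - i : ℕ) with hp
  have hpm : ∀ i, (p i).Monic := by
    intro i
    simp only [hp]
    split_ifs
    · exact hqm.mul (Polynomial.monic_X_pow _)
    · exact Polynomial.monic_X_pow _
  have hpd : ∀ i, (p i).natDegree = k + l - 1 - i := by
    intro i
    simp only [hp]
    split_ifs
    · rw [hqm.natDegree_mul (Polynomial.monic_X_pow _), hqd, Polynomial.natDegree_X_pow]
      omega
    · rw [Polynomial.natDegree_X_pow]
  rw [det_add_flip_eval _ _ _ p hpd hpm, ← Matrix.det_submatrix_equiv_self finSumFinEquiv,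
    ← det_rev, ← alternant_rev, alternant, ← Matrix.det_mul_row]
  set M := (Matrix.of fun i j => interPos k z b j * (p i).eval (z j ^ 2) +
    interNeg s k z b j * (p i).eval (z j ^ 2)⁻¹).submatrix finSumFinEquiv finSumFinEquiv with hM
  rw [← Matrix.det_fromBlocks_zero₁₂ _ M.toBlocks₂₁]
  congr 1
  have hne : ∀ (i : Fin k) (r : Fin l), 1 - z (Fin.castAdd l i) ^ 2 * z (Fin.natAdd k r) ^ 2 ≠ 0 :=
    fun i r h => hz.mul_ne_one (Fin.castAdd l i) (Fin.natAdd k r) (sub_eq_zero.1 h).symm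
  have hne' : ∀ (i : Fin k) (r : Fin l),
      1 - (z (Fin.castAdd l i) ^ 2)⁻¹ * z (Fin.natAdd k r) ^ 2 ≠ 0 := by
    intro i r h
    have h1 := hz.inj ((inv_mul_eq_one₀ (hz.ne_zero _)).1 (sub_eq_zero.1 h).symm)
    have := congrArg Fin.val h1
    simp at this
    omega
  ext (i | i) (j | j)
  · have hj := hz0 (Fin.castAdd l j)
    have hi : ((k - 1 - i : ℕ) : ℤ) = k - 1 - (i : ℕ) := by
      have := i.2
      omega
    have e1 : q.eval (z (Fin.castAdd l j) ^ 2) = z (Fin.castAdd l j) ^ (2 * (l : ℤ)) *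
        ∏ r : Fin l, (1 - (z (Fin.castAdd l j) ^ 2)⁻¹ * z (Fin.natAdd k r) ^ 2) := by
      have : z (Fin.castAdd l j) ^ (2 * (l : ℤ)) = ∏ _r : Fin l, z (Fin.castAdd l j) ^ 2 := by
        rw [_root_.zpow_mul]
        simp
      rw [hq, Polynomial.eval_prod, this, ← Finset.prod_mul_distrib]
      refine Finset.prod_congr rfl fun r _ => ?_
      simp only [Polynomial.eval_sub, Polynomial.eval_X, Polynomial.eval_C]
      field_simp
    have e2 : q.eval (z (Fin.castAdd l j) ^ 2)⁻¹ = z (Fin.castAdd l j) ^ (-(2 * (l : ℤ))) *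
        ∏ r : Fin l, (1 - z (Fin.castAdd l j) ^ 2 * z (Fin.natAdd k r) ^ 2) := by
      have : z (Fin.castAdd l j) ^ (-(2 * (l : ℤ))) =
          ∏ _r : Fin l, (z (Fin.castAdd l j) ^ 2)⁻¹ := by
        rw [_root_.zpow_neg, _root_.zpow_mul]
        simp
      rw [hq, Polynomial.eval_prod, this, ← Finset.prod_mul_distrib]
      refine Finset.prod_congr rfl fun r _ => ?_
      simp only [Polynomial.eval_sub, Polynomial.eval_X, Polynomial.eval_C]
      field_simp
    have hP : ∏ r : Fin l, (1 - z (Fin.castAdd l j) ^ 2 * z (Fin.natAdd k r) ^ 2) ≠ 0 :=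
      Finset.prod_ne_zero_iff.2 fun r _ => hne j r
    have hP' : ∏ r : Fin l, (1 - (z (Fin.castAdd l j) ^ 2)⁻¹ * z (Fin.natAdd k r) ^ 2) ≠ 0 :=
      Finset.prod_ne_zero_iff.2 fun r _ => hne' j r
    have e3 : (z (Fin.castAdd l j) ^ 2) ^ (k - 1 - i : ℕ) =
        z (Fin.castAdd l j) ^ (2 * ((k : ℤ) - 1 - (i : ℕ))) := by
      rw [_root_.zpow_mul, ← hi, zpow_natCast]
      norm_cast
    simp only [hM, hp, interPos, interNeg, prod_filter_le_val, Matrix.submatrix_apply,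
      Matrix.of_apply, finSumFinEquiv_apply_left, Fin.val_castAdd, Fin.is_lt, if_true,
      Polynomial.eval_mul, Polynomial.eval_pow, Polynomial.eval_X, e1, e2,
      Matrix.fromBlocks_apply₁₁, Function.comp, inv_pow, e3]
    rw [show (b + 2 + 2 * ((k : ℤ) - 1 - (i : ℕ))) =
      (b + 2 * ((k : ℤ) - (k + l : ℕ) + 1)) + 2 * l + 2 * ((k : ℤ) - 1 - (i : ℕ)) by
        push_cast; ring]
    generalize ∏ r : Fin l, (1 - z (Fin.castAdd l j) ^ 2 * z (Fin.natAdd k r) ^ 2) = Q at hP ⊢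
    generalize ∏ r : Fin l, (1 - (z (Fin.castAdd l j) ^ 2)⁻¹ * z (Fin.natAdd k r) ^ 2) = Q' at hP' ⊢
    generalize b + 2 * ((k : ℤ) - (k + l : ℕ) + 1) = u
    generalize 2 * (l : ℤ) = v
    generalize 2 * ((k : ℤ) - 1 - (i : ℕ)) = w
    rw [neg_add, neg_add, zpow_add₀ hj, zpow_add₀ hj, zpow_add₀ hj, zpow_add₀ hj,
      _root_.zpow_neg _ w]
    field_simp
  · simp only [hM, hp, interPos, interNeg, Matrix.submatrix_apply, Matrix.of_apply,
      finSumFinEquiv_apply_left, finSumFinEquiv_apply_right, Fin.val_castAdd, Fin.val_natAdd,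
      Fin.is_lt, if_true, Polynomial.eval_mul, Matrix.fromBlocks_apply₁₂, Matrix.zero_apply]
    have hroot : q.eval (z (Fin.natAdd k j) ^ 2) = 0 := by
      rw [hq, Polynomial.eval_prod]
      exact Finset.prod_eq_zero (Finset.mem_univ j) (by simp)
    simp [hroot]
  · rfl
  · simp [hM, hp, interPos, interNeg, Nat.add_sub_add_left, Nat.sub_sub,
      Nat.add_left_comm 1 k]

/-- The alternating sum of intermediate symplectic characters over any field of characteristic
different from two, at generic arguments. -/
lemma sum_spInterD_sub {k l m : ℕ} (h2 : (2 : F) ≠ 0) (hm : 0 < m) {z : Fin (k + l) → F}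
    (hz : Generic fun j => z j ^ 2) {a : ℤ} (ha : 0 ≤ a) :
    ∑ lam ∈ colParts 0 m (k + l), spInterD k z (fun i => 2 * (lam i : ℤ) + a) -
      ∑ lam ∈ colParts 1 m (k + l), spInterD k z (fun i => 2 * (lam i : ℤ) + a) =
    (-1) ^ (k + l) * spD z (fun _ => (m : ℤ) - 2) *
      soDD (z ∘ Fin.castAdd l) (fun _ => (m : ℤ) + a + 2) *
      ∏ i ∈ Finset.univ.filter (fun i : Fin (k + l) => k ≤ (i : ℕ)),
        z i ^ ((m : ℤ) + a) * (z i ^ 2 - (z i ^ 2)⁻¹) := by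
  have hz0 : ∀ j, z j ≠ 0 := fun j h => hz.ne_zero j (by simp [h])
  have hk0 : ∀ j, (z ∘ Fin.castAdd l) j ≠ 0 := fun j => hz0 _
  have hzk : Generic fun j => (z ∘ Fin.castAdd l) j ^ 2 :=
    hz.comp (Fin.castAdd_injective k l)
  have hzl : Generic fun r => z (Fin.natAdd k r) ^ 2 := hz.comp (Fin.natAdd_injective l k)
  have hsum := sum_interMatD h2 k hm hz a
  rw [det_inter 1 hz] at hsum
  have hden : (interMatD k z fun _ => 0).det =
      Equiv.Perm.sign (Fin.revPerm (n := k)) * symDet (-1) 2 (z ∘ Fin.castAdd l) *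
        pairProd (fun a b => a - b) fun r => z (Fin.natAdd k r) ^ 2 := by
    have h := det_inter (-1) hz 0
    have h' := interMatD_eq k hz0 0 fun _ => 0
    simp only [Nat.cast_zero, mul_zero, add_zero, zero_add] at h'
    simpa [h'] using h
  simp only [spInterD, ← Finset.sum_div, ← sub_div]
  rw [hden, spD_const, soDD_const _ (by omega), symDet_one_zero hk0,
    symDet_neg_one_two hz0, symDet_neg_one_two hk0, prod_filter_le_val,
    Finset.prod_mul_distrib, Fin.prod_univ_add]
  have hW := hz.symVandermonde_ne_zero
  have hWk := hzk.symVandermonde_ne_zero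
  have hV : (pairProd (fun a b => a - b) fun r => z (Fin.natAdd k r) ^ 2) ≠ 0 :=
    Finset.prod_ne_zero_iff.2 fun i _ => Finset.prod_ne_zero_iff.2 fun j hj h =>
      (Finset.mem_Ioi.1 hj).ne (hzl.inj (sub_eq_zero.1 h))
  have hx : ∀ j, z j ^ 2 - (z j ^ 2)⁻¹ ≠ 0 := fun j h =>
    hz.mul_ne_one j j ((mul_eq_one_iff_eq_inv₀ (hz.ne_zero j)).2 (sub_eq_zero.1 h))
  have hxk : ∏ j : Fin k, (z (Fin.castAdd l j) ^ 2 - (z (Fin.castAdd l j) ^ 2)⁻¹) ≠ 0 :=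
    Finset.prod_ne_zero_iff.2 fun j _ => hx _
  have hxl : ∏ j : Fin l, (z (Fin.natAdd k j) ^ 2 - (z (Fin.natAdd k j) ^ 2)⁻¹) ≠ 0 :=
    Finset.prod_ne_zero_iff.2 fun j _ => hx _
  have hc : (if 0 < k then (2 : F) else 1) ≠ 0 := by split_ifs <;> simp [h2]
  have hsgn := sign_revPerm_ne_zero (F := F) k
  simp only [Function.comp, sub_add_cancel] at *
  rw [← eq_div_iff hW] at hsum
  rw [hsum, show (m : ℤ) + a = a + m by ring]
  generalize (∏ j : Fin k, (z (Fin.castAdd l j) ^ 2 - (z (Fin.castAdd l j) ^ 2)⁻¹)) = A at *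
  generalize (∏ j : Fin l, (z (Fin.natAdd k j) ^ 2 - (z (Fin.natAdd k j) ^ 2)⁻¹)) = B at *
  generalize (if 0 < k then (2 : F) else 1) = c at *
  generalize ((Equiv.Perm.sign (Fin.revPerm (n := k)) : ℤ) : F) = σ at *
  generalize (pairProd (fun a b => a - b) fun r => z (Fin.natAdd k r) ^ 2) = V at *
  generalize (symVandermonde fun j => z j ^ 2) = W at *
  generalize (symVandermonde fun j => z (Fin.castAdd l j) ^ 2) = W' at *
  field_simp

lemma generic_gen_sq (n : ℕ) : Generic fun j => gen n j ^ 2 := by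
  have hinj : Function.Injective (algebraMap (MvPolynomial (Fin n) ℚ) (FF n)) :=
    IsFractionRing.injective _ _
  simp only [gen, ← map_pow]
  refine ⟨fun i h => ?_, fun i j h => ?_, fun i j h => ?_⟩
  · exact pow_ne_zero 2 (MvPolynomial.X_ne_zero i) ((map_eq_zero_iff _ hinj).1 h)
  · have := congrArg (MvPolynomial.eval fun l => if l = i then (1 : ℚ) else 0) (hinj h)
    by_contra hij
    simp [Ne.symm hij] at this
  · rw [← map_mul, map_eq_one_iff _ hinj] at h
    simpa using congrArg (MvPolynomial.eval fun _ => (0 : ℚ)) h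

lemma sum_fin_filter {n m r : ℕ} (p : (Fin n → Fin (m + 1)) → Prop) [DecidablePred p]
    (g : (Fin n → ℕ) → F)
    (hp : ∀ lam : Fin n → Fin (m + 1), p lam ↔ (Antitone fun i => (lam i : ℕ)) ∧
      ∀ c : ℕ, 1 ≤ c → c ≤ m →
        Even ((Finset.univ.filter (fun j : Fin n => c ≤ (lam j : ℕ))).card + r)) :
    ∑ lam ∈ Finset.univ.filter p, g (fun i => lam i) = ∑ lam ∈ colParts r m n, g lam := by
  have hmem : ∀ lam : Fin n → Fin (m + 1),
      lam ∈ Finset.univ.filter p ↔ (fun i => (lam i : ℕ)) ∈ colParts r m n := by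
    intro lam
    rw [Finset.mem_filter, hp, mem_colParts]
    simp [Nat.lt_succ_iff.1 (lam _).2]
  refine Finset.sum_bij' (fun lam _ i => (lam i : ℕ))
    (fun lam h i => ⟨lam i, Nat.lt_succ_of_le ((mem_colParts.1 h).1 i)⟩) ?_ ?_ ?_ ?_ ?_
  · exact fun lam h => (hmem lam).1 h
  · exact fun lam h => (hmem _).2 h
  · exact fun _ _ => rfl
  · exact fun _ _ => rfl
  · exact fun _ _ => rfl

/-- **Theorem (main theorem, part (4)).**  For `1 ≤ n`, `0 ≤ k ≤ n`, `m` a positive integer and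
`a = a2/2` a nonnegative half-integer, the sum of the intermediate symplectic characters
`sp^{(k,n-k)}_{λ+(a^n)}(x_1,…,x_k | x_{k+1},…,x_n)` over all partitions `λ ⊆ (m^n)` all of whose
column lengths `λ′_c` (`1 ≤ c ≤ m`) are even, minus the corresponding sum over those all of whose
column lengths are odd, equals `(-1)^n · sp_{((m/2-1)^n)}(x_1,…,x_n) ·
so^D_{((m/2+a+1)^k)}(x_1,…,x_k) · ∏_{i=k+1}^n x_i^{m/2+a} (x_i - x_i^{-1})`, as an identity in
`ℚ(x_1^{1/2}, …, x_n^{1/2})`.  Here `gen n i` plays the role of `x_i^{1/2}`, all weights are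
doubled, and the column length `λ′_c` is the number of indices `j` with `λ_j ≥ c`. -/
theorem sum_spInter_evenodd_columns_diff (n k m : ℕ) (a2 : ℤ) (hn : 1 ≤ n) (hk : k ≤ n)
    (hm : 0 < m) (ha : 0 ≤ a2) :
    (∑ lam ∈ Finset.univ.filter
        (fun lam : Fin n → Fin (m + 1) =>
          (Antitone fun i => (lam i : ℕ)) ∧
          ∀ c : ℕ, 1 ≤ c → c ≤ m →
            Even (Finset.univ.filter (fun j : Fin n => c ≤ (lam j : ℕ))).card),
        spInterD k (gen n) (fun i => 2 * ((lam i : ℕ) : ℤ) + a2)) -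
    (∑ lam ∈ Finset.univ.filter
        (fun lam : Fin n → Fin (m + 1) =>
          (Antitone fun i => (lam i : ℕ)) ∧
          ∀ c : ℕ, 1 ≤ c → c ≤ m →
            Odd (Finset.univ.filter (fun j : Fin n => c ≤ (lam j : ℕ))).card),
        spInterD k (gen n) (fun i => 2 * ((lam i : ℕ) : ℤ) + a2)) =
    (-1 : FF n) ^ n * spD (gen n) (fun _ => (m : ℤ) - 2) *
      soDD (fun i : Fin k => gen n (Fin.castLE hk i)) (fun _ => (m : ℤ) + a2 + 2) *
      ∏ i ∈ Finset.univ.filter (fun i : Fin n => k ≤ (i : ℕ)),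
        gen n i ^ ((m : ℤ) + a2) * (gen n i ^ 2 - (gen n i ^ 2)⁻¹) := by
  obtain ⟨l, rfl⟩ := Nat.exists_eq_add_of_le hk
  rw [sum_fin_filter (r := 0) _
      (fun lam => spInterD k (gen (k + l)) (fun i => 2 * (lam i : ℤ) + a2)) (fun lam => by simp),
    sum_fin_filter (r := 1) _
      (fun lam => spInterD k (gen (k + l)) (fun i => 2 * (lam i : ℤ) + a2))
      (fun lam => by simp [Nat.even_add_one])]
  exact sum_spInterD_sub two_ne_zero hm (generic_gen_sq (k + l)) ha
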